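/- arXiv:2009.01633 — 3 statements merged into one kernel-verified Lean document; each statement's English description precedes it below -/
import Mathlib

section
/- Let K > 0 and let γ : ℝ → EuclideanSpace ℝ (Fin 2) be twice differentiable with ‖γ'(s)‖ = 1 for all s (arc-length parameterization) and ‖γ''(s)‖ ≤ K for all s (bounded curvature). Then for all s₁, s₂ ∈ ℝ with |s₁ − s₂| ≤ 1/(2K), the chord satisfies ‖γ(s₁) − γ(s₂)‖ ≥ |s₁ − s₂|/√2. -/
/-- A unit-speed curve whose velocity is `K`-Lipschitz deviates from its tangent line at the midpoint
of an arc of length `L = |s₁ - s₂|` with speed at most `K * L / 2`, so the chord of that arc has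
length at least `(1 - K * L / 2) * L`. -/
theorem mul_abs_sub_le_norm_sub_of_norm_deriv_deriv_le {E : Type*} [NormedAddCommGroup E]
    [NormedSpace ℝ E] {K : ℝ} (hK : 0 ≤ K) {γ : ℝ → E}
    (hγ : Differentiable ℝ γ) (hγ' : Differentiable ℝ (deriv γ))
    (hunit : ∀ s, ‖deriv γ s‖ = 1) (hcurv : ∀ s, ‖deriv (deriv γ) s‖ ≤ K) (s₁ s₂ : ℝ) :
    (1 - K * (|s₁ - s₂| / 2)) * |s₁ - s₂| ≤ ‖γ s₁ - γ s₂‖ := by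
  set m := (s₁ + s₂) / 2 with hm
  have hderiv (s : ℝ) :
      HasDerivAt (fun t ↦ γ t - t • deriv γ m) (deriv γ s - deriv γ m) s := by
    simpa using (hγ s).hasDerivAt.fun_sub ((hasDerivAt_id s).smul_const (deriv γ m))
  have hbound : ∀ s ∈ Metric.closedBall m (|s₁ - s₂| / 2),
      ‖deriv γ s - deriv γ m‖ ≤ K * (|s₁ - s₂| / 2) := fun s hs ↦
    (convex_univ.norm_image_sub_le_of_norm_deriv_le (fun x _ ↦ hγ' x) (fun x _ ↦ hcurv x)
      (Set.mem_univ m) (Set.mem_univ s)).trans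
      (mul_le_mul_of_nonneg_left (mem_closedBall_iff_norm.1 hs) hK)
  have h₁ : s₁ ∈ Metric.closedBall m (|s₁ - s₂| / 2) := by
    rw [mem_closedBall_iff_norm, Real.norm_eq_abs,
      show s₁ - m = (s₁ - s₂) / 2 by rw [hm]; ring, abs_div, abs_two]
  have h₂ : s₂ ∈ Metric.closedBall m (|s₁ - s₂| / 2) := by
    rw [mem_closedBall_iff_norm, Real.norm_eq_abs,
      show s₂ - m = -((s₁ - s₂) / 2) by rw [hm]; ring, abs_neg, abs_div, abs_two]
  have hdev := (convex_closedBall m _).norm_image_sub_le_of_norm_hasDerivWithin_le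
    (fun s _ ↦ (hderiv s).hasDerivWithinAt) hbound h₂ h₁
  have htri := norm_sub_norm_le ((s₁ - s₂) • deriv γ m) (γ s₁ - γ s₂)
  rw [norm_sub_rev (_ • _), norm_smul, hunit, mul_one, Real.norm_eq_abs,
    show γ s₁ - γ s₂ - (s₁ - s₂) • deriv γ m
      = γ s₁ - s₁ • deriv γ m - (γ s₂ - s₂ • deriv γ m) by rw [sub_smul]; abel] at htri
  rw [Real.norm_eq_abs] at hdev
  linarith

/-- Chord lower bound (equation (2.9)): an arc-length parameterized planar curve with
curvature bounded by `K` satisfies `‖γ(s₁) − γ(s₂)‖ ≥ |s₁ − s₂|/√2` for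
`|s₁ − s₂| ≤ 1/(2K)`. -/
theorem chord_lower_bound (K : ℝ) (hK : 0 < K)
    (γ : ℝ → EuclideanSpace ℝ (Fin 2))
    (hγ : Differentiable ℝ γ) (hγ' : Differentiable ℝ (deriv γ))
    (hunit : ∀ s, ‖deriv γ s‖ = 1)
    (hcurv : ∀ s, ‖deriv (deriv γ) s‖ ≤ K) :
    ∀ s₁ s₂ : ℝ, |s₁ - s₂| ≤ 1 / (2 * K) →
      ‖γ s₁ - γ s₂‖ ≥ |s₁ - s₂| / Real.sqrt 2 := by
  intro s₁ s₂ hs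
  have hKs : K * |s₁ - s₂| ≤ 1 / 2 :=
    (mul_le_mul_of_nonneg_left hs hK.le).trans_eq (by field_simp)
  have hsqrt : 4 / 3 ≤ Real.sqrt 2 := Real.le_sqrt_of_sq_le (by norm_num)
  calc |s₁ - s₂| / Real.sqrt 2 ≤ |s₁ - s₂| / (4 / 3) := by gcongr
    _ = (1 - 1 / 4) * |s₁ - s₂| := by ring
    _ ≤ (1 - K * (|s₁ - s₂| / 2)) * |s₁ - s₂| := by gcongr; linarith
    _ ≤ ‖γ s₁ - γ s₂‖ :=
      mul_abs_sub_le_norm_sub_of_norm_deriv_deriv_le hK.le hγ hγ' hunit hcurv s₁ s₂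
end

section
/- Let W : ℝ → ℝ be three times continuously differentiable and let φ : ℝ → ℝ be four times differentiable with φ''(z) = W'(φ(z)) for all z ∈ ℝ. Define u(z) := z·φ'(z) and L v := −v'' + (W'' ∘ φ)·v. Then the twice-iterated operator satisfies L(L u)(z) = 2·W'''(φ(z))·(φ'(z))² for all z ∈ ℝ. -/
/-- The linearized operator `L v := −v'' + W''(φ)·v` about the pulse profile `φ`. -/
noncomputable def linearizedOp (W φ : ℝ → ℝ) (v : ℝ → ℝ) : ℝ → ℝ :=
  fun z => -deriv (deriv v) z + deriv (deriv W) (φ z) * v z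

/-- `L₀²(z φ₀') = 2 W'''(φ₀)|φ₀'|²` (equations (3.12)–(3.13)). -/
theorem L_squared_z_phi_deriv (W φ : ℝ → ℝ) (hW : ContDiff ℝ 3 W)
    (hφ1 : Differentiable ℝ φ) (hφ2 : Differentiable ℝ (deriv φ))
    (hφ3 : Differentiable ℝ (deriv (deriv φ)))
    (hφ4 : Differentiable ℝ (deriv (deriv (deriv φ))))
    (hprofile : ∀ z, deriv (deriv φ) z = deriv W (φ z)) :
    ∀ z, linearizedOp W φ (linearizedOp W φ (fun t => t * deriv φ t)) z
      = 2 * deriv (deriv (deriv W)) (φ z) * (deriv φ z) ^ 2 := by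
  have hW1 : ContDiff ℝ 2 (deriv W) := ContDiff.deriv' (by simpa [two_add_one_eq_three] using hW)
  have hW2 : ContDiff ℝ 1 (deriv (deriv W)) :=
    ContDiff.deriv' (by simpa [one_add_one_eq_two] using hW1)
  have hdW1 : Differentiable ℝ (deriv W) := hW1.differentiable (by norm_num)
  have hdW2 : Differentiable ℝ (deriv (deriv W)) := hW2.differentiable (by norm_num)
  have h3 : deriv (deriv (deriv φ)) = fun z => deriv (deriv W) (φ z) * deriv φ z := by
    rw [show deriv (deriv φ) = fun z => deriv W (φ z) from funext hprofile]
    exact funext fun z => ((hdW1 (φ z)).hasDerivAt.comp z (hφ1 z).hasDerivAt).deriv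
  have h4 (z : ℝ) : deriv (deriv (deriv (deriv φ))) z =
      deriv (deriv (deriv W)) (φ z) * deriv φ z * deriv φ z +
        deriv (deriv W) (φ z) * deriv (deriv φ) z := by
    rw [h3]
    exact (((hdW2 (φ z)).hasDerivAt.comp z (hφ1 z).hasDerivAt).mul (hφ2 z).hasDerivAt).deriv
  have hmul {f : ℝ → ℝ} (hf : Differentiable ℝ f) (t : ℝ) :
      HasDerivAt (fun t => t * f t) (f t + t * deriv f t) t := by
    have h := (hasDerivAt_id' t).mul (hf t).hasDerivAt
    rw [one_mul] at h
    exact h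
  have hu1 : deriv (fun t => t * deriv φ t) = fun t => deriv φ t + t * deriv (deriv φ) t :=
    funext fun t => (hmul hφ2 t).deriv
  have hu2 (t : ℝ) : deriv (fun t => deriv φ t + t * deriv (deriv φ) t) t =
      deriv (deriv φ) t + (deriv (deriv φ) t + t * deriv (deriv (deriv φ)) t) :=
    ((hφ2 t).hasDerivAt.add (hmul hφ3 t)).deriv
  have hLu : linearizedOp W φ (fun t => t * deriv φ t) = fun t => -2 * deriv (deriv φ) t := by
    funext t
    simp only [linearizedOp, hu1, hu2, h3]
    ring
  have hLu1 : deriv (fun t => -2 * deriv (deriv φ) t) =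
      fun t => -2 * deriv (deriv (deriv φ)) t :=
    funext fun t => ((hφ3 t).hasDerivAt.const_mul (-2)).deriv
  have hLu2 (t : ℝ) : deriv (fun t => -2 * deriv (deriv (deriv φ)) t) t =
      -2 * deriv (deriv (deriv (deriv φ))) t :=
    ((hφ4 t).hasDerivAt.const_mul (-2)).deriv
  intro z
  rw [hLu]
  simp only [linearizedOp, hLu1, hLu2, h4]
  ring
end

section
/- Let L > 0, a, b ∈ ℝ, and let h, f, g : ℝ → ℝ be L-periodic with h continuously differentiable and f, g twice continuously differentiable, satisfying f''(s) = −a·f(s) and g''(s) = −b·g(s) for all s. Then (b − a)·∫₀ᴸ h·f·g ds = ∫₀ᴸ h'·(f·g' − f'·g) ds. -/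
/-- Key integration-by-parts identity (4.11) of Lemma 4.1: for `L`-periodic functions
`h, f, g` with `f'' = −a f` and `g'' = −b g`,
`(b − a)·∫₀ᴸ h f g = ∫₀ᴸ h'·(f g' − f' g)`. -/
theorem periodic_eigen_ibp (L : ℝ) (hL : 0 < L) (a b : ℝ) (h f g : ℝ → ℝ)
    (hhper : Function.Periodic h L) (hfper : Function.Periodic f L)
    (hgper : Function.Periodic g L)
    (hh : ContDiff ℝ 1 h) (hf : ContDiff ℝ 2 f) (hg : ContDiff ℝ 2 g)
    (hfeq : ∀ s, deriv (deriv f) s = -a * f s)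
    (hgeq : ∀ s, deriv (deriv g) s = -b * g s) :
    (b - a) * ∫ s in (0:ℝ)..L, h s * f s * g s
      = ∫ s in (0:ℝ)..L, deriv h s * (f s * deriv g s - deriv f s * g s) := by
  have hderiv : ∀ {u : ℝ → ℝ}, Function.Periodic u L → deriv u L = deriv u 0 := by
    intro u hu
    have := deriv_comp_add_const u L 0
    rwa [zero_add, funext hu, eq_comm] at this
  have hf' : ContDiff ℝ 1 (deriv f) := hf.deriv'
  have hg' : ContDiff ℝ 1 (deriv g) := hg.deriv'
  have hW : ∀ s, HasDerivAt (fun t => f t * deriv g t - deriv f t * g t)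
      ((a - b) * (f s * g s)) s := by
    intro s
    have f1 := (hf.differentiable two_ne_zero s).hasDerivAt
    have g1 := (hg.differentiable two_ne_zero s).hasDerivAt
    have f2 := (hf'.differentiable one_ne_zero s).hasDerivAt
    have g2 := (hg'.differentiable one_ne_zero s).hasDerivAt
    refine ((f1.mul g2).sub (f2.mul g1)).congr_deriv ?_
    rw [hfeq, hgeq]
    ring
  have hcont : Continuous fun s => (a - b) * (f s * g s) :=
    continuous_const.mul (hf.continuous.mul hg.continuous)
  have key := intervalIntegral.integral_mul_deriv_eq_deriv_mul (a := 0) (b := L)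
    (fun s _ => (hh.differentiable one_ne_zero s).hasDerivAt) (fun s _ => hW s)
    ((hh.continuous_deriv le_rfl).intervalIntegrable 0 L) (hcont.intervalIntegrable 0 L)
  rw [hderiv hfper, hderiv hgper, hhper.eq, hfper.eq, hgper.eq, sub_self, zero_sub] at key
  rw [← neg_eq_iff_eq_neg.mpr key, ← intervalIntegral.integral_neg,
    ← intervalIntegral.integral_const_mul]
  congr 1
  ext s
  ring
end
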